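/- Existence theorem: Let α, β > 0, ℓ ∈ ℤ, and let w, T_A, T_C be C¹ on ℝ with e^{(1−α)t}T_A → 0, e^{(1−α)t}T_C → 0, e^{−αt}w → 0 as t → −∞; e^{(1+α)t}T_A → 0, e^{(1+α)t}T_C → 0, e^{αt}(w − 2ℓπ) → 0, e^{αt}w' → 0 as t → +∞; and e^t T_A', e^t T_C', w'' have limits as t → ∞. Then there exists a solution y on (−∞,∞) of y'' + y' + 2[w cos(y+w) − sin(y+w)] + β e^t[T_A(cos(y+w)−1) − T_C sin(y+w)] = 0 with lim_{t→−∞} y(t) = 2nπ and lim_{t→+∞} y(t) = arctan(2ℓπ) + mπ for some integers n, m. -/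

import Mathlib

open Real Set Filter MeasureTheory
open scoped BoundedContinuousFunction Topology

lemma aux_integrable {c : ℝ} (hc : 0 < c) (G : ℝ →ᵇ ℝ) (t : ℝ) :
    IntegrableOn (fun s => Real.exp (c * s) * G s) (Iic t) := by
  have h := (integrableOn_exp_mul_Iic hc t)
  refine Integrable.mono' (h.mul_const ‖G‖) ?_ ?_
  · exact Continuous.aestronglyMeasurable (by fun_prop)
  · refine Eventually.of_forall (fun s => ?_)
    rw [norm_mul, Real.norm_eq_abs (Real.exp _), abs_of_pos (Real.exp_pos _)]
    exact mul_le_mul_of_nonneg_left (G.norm_coe_le_norm s) (Real.exp_pos _).le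

noncomputable def auxV (c : ℝ) (G : ℝ → ℝ) (t : ℝ) : ℝ :=
  Real.exp (-c * t) * ∫ s in Iic t, Real.exp (c * s) * G s

lemma auxV_bound {c : ℝ} (hc : 0 < c) (G : ℝ →ᵇ ℝ) (t : ℝ) : |auxV c G t| ≤ ‖G‖ / c := by
  have h := (integrableOn_exp_mul_Iic hc t)
  have h1 : ‖∫ s in Iic t, Real.exp (c * s) * G s‖ ≤ ∫ s in Iic t, Real.exp (c * s) * ‖G‖ := by
    refine norm_integral_le_of_norm_le (h.mul_const ‖G‖) (Eventually.of_forall (fun s => ?_))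
    rw [norm_mul, Real.norm_eq_abs (Real.exp _), abs_of_pos (Real.exp_pos _)]
    exact mul_le_mul_of_nonneg_left (G.norm_coe_le_norm s) (Real.exp_pos _).le
  rw [integral_mul_const, integral_exp_mul_Iic hc, Real.norm_eq_abs] at h1
  unfold auxV
  rw [abs_mul, abs_of_pos (Real.exp_pos _)]
  calc _ ≤ Real.exp (-c * t) * (Real.exp (c * t) / c * ‖G‖) :=
        mul_le_mul_of_nonneg_left h1 (Real.exp_pos _).le
    _ = (Real.exp (-c * t) * Real.exp (c * t)) * (‖G‖ / c) := by ring
    _ = ‖G‖ / c := by rw [← Real.exp_add]; simp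

lemma auxV_sub {c : ℝ} (hc : 0 < c) (G H : ℝ →ᵇ ℝ) (t : ℝ) :
    auxV c G t - auxV c H t = auxV c (G - H : ℝ →ᵇ ℝ) t := by
  unfold auxV
  rw [← mul_sub, ← integral_sub (aux_integrable hc G t) (aux_integrable hc H t)]
  congr 1
  refine integral_congr_ae (Eventually.of_forall (fun s => ?_))
  simp [mul_sub]

lemma auxV_deriv {c : ℝ} (hc : 0 < c) (G : ℝ →ᵇ ℝ) (t : ℝ) :
    HasDerivAt (auxV c G) (G t - c * auxV c G t) t := by
  have hcont : Continuous (fun s => Real.exp (c * s) * G s) := by fun_prop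
  have h1 : HasDerivAt (fun x => ∫ s in Iic x, Real.exp (c * s) * G s)
      (Real.exp (c * t) * G t) t := by
    have h2 : HasDerivAt (fun x => (∫ s in (0:ℝ)..x, Real.exp (c * s) * G s)
        + ∫ s in Iic 0, Real.exp (c * s) * G s) (Real.exp (c * t) * G t) t :=
      (hcont.integral_hasStrictDerivAt 0 t).hasDerivAt.add_const _
    refine h2.congr_of_eventuallyEq (Eventually.of_forall (fun x => ?_))
    simp only
    rw [← intervalIntegral.integral_Iic_sub_Iic (aux_integrable hc G 0) (aux_integrable hc G x)]
    ring
  have h3 : HasDerivAt (fun x => Real.exp (-c * x)) (Real.exp (-c * t) * (-c)) t := by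
    simpa using ((hasDerivAt_id t).const_mul (-c)).exp
  have h4 := h3.mul h1
  have he : Real.exp (-c * t) * Real.exp (c * t) = 1 := by rw [← Real.exp_add]; simp
  unfold auxV
  refine h4.congr_deriv ?_
  linear_combination (G t) * he

lemma solver_pos {c : ℝ} (hc : 0 < c) : ∃ S : (ℝ →ᵇ ℝ) → (ℝ →ᵇ ℝ),
    (∀ G t, HasDerivAt (S G) (G t - c * S G t) t) ∧
    (∀ G H, ‖S G - S H‖ ≤ ‖G - H‖ / c) ∧ (∀ G, ‖S G‖ ≤ ‖G‖ / c) := by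
  refine ⟨fun G => BoundedContinuousFunction.ofNormedAddCommGroup (auxV c G)
    (continuous_iff_continuousAt.2 fun t => (auxV_deriv hc G t).continuousAt) (‖G‖ / c)
    (auxV_bound hc G), fun G t => auxV_deriv hc G t, fun G H => ?_, fun G => ?_⟩
  · refine (BoundedContinuousFunction.norm_le (by positivity)).2 (fun t => ?_)
    have := auxV_bound hc (G - H) t
    rw [← auxV_sub hc] at this
    exact this
  · exact (BoundedContinuousFunction.norm_le (by positivity)).2 (auxV_bound hc G)

noncomputable def auxRefl (G : ℝ →ᵇ ℝ) : ℝ →ᵇ ℝ :=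
  G.compContinuous ⟨fun t => -t, continuous_neg⟩

lemma auxRefl_norm (G : ℝ →ᵇ ℝ) : ‖auxRefl G‖ ≤ ‖G‖ :=
  (BoundedContinuousFunction.norm_le (norm_nonneg _)).2 (fun t => G.norm_coe_le_norm (-t))

lemma auxRefl_sub (G H : ℝ →ᵇ ℝ) : auxRefl G - auxRefl H = auxRefl (G - H) := by
  ext t; simp [auxRefl]

lemma solver {c : ℝ} (hc : c ≠ 0) : ∃ S : (ℝ →ᵇ ℝ) → (ℝ →ᵇ ℝ),
    (∀ G t, HasDerivAt (S G) (G t - c * S G t) t) ∧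
    (∀ G H, ‖S G - S H‖ ≤ ‖G - H‖ / |c|) ∧ (∀ G, ‖S G‖ ≤ ‖G‖ / |c|) := by
  rcases lt_or_gt_of_ne hc with h | h
  · obtain ⟨S, h1, h2, h3⟩ := solver_pos (neg_pos.2 h)
    rw [abs_of_neg h]
    have hc' := neg_pos.2 h
    refine ⟨fun G => - auxRefl (S (auxRefl G)), fun G t => ?_, fun G H => ?_, fun G => ?_⟩
    · have := (h1 (auxRefl G) (-t)).comp t (hasDerivAt_neg t)
      have := this.neg
      refine this.congr_deriv ?_
      simp [auxRefl]
    · rw [neg_sub_neg, auxRefl_sub, norm_sub_rev G H]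
      refine (auxRefl_norm _).trans ((h2 _ _).trans ?_)
      rw [auxRefl_sub]
      gcongr
      exact auxRefl_norm _
    · rw [norm_neg]
      refine (auxRefl_norm _).trans ((h3 _).trans ?_)
      gcongr
      exact auxRefl_norm _
  · rw [abs_of_pos h]
    exact solver_pos h

lemma fixed_solution {c1 c2 L C : ℝ} (hc1 : c1 ≠ 0) (hc2 : c2 ≠ 0) (hL : 0 ≤ L)
    (hLc : L < |c1| * |c2|) (G : ℝ → ℝ → ℝ) (hG : Continuous (Function.uncurry G))
    (hlip : ∀ t x x', |G t x - G t x'| ≤ L * |x - x'|) (h0 : ∀ t, |G t 0| ≤ C) :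
    ∃ u v : ℝ → ℝ, (∀ t, HasDerivAt u (v t - c2 * u t) t) ∧
      (∀ t, HasDerivAt v (G t (u t) - c1 * v t) t) ∧
      (∀ t, |u t| * (|c1| * |c2| - L) ≤ C) := by
  obtain ⟨S1, a1, a2, a3⟩ := solver hc1
  obtain ⟨S2, b1, b2, b3⟩ := solver hc2
  have hp1 : 0 < |c1| := abs_pos.2 hc1
  have hp2 : 0 < |c2| := abs_pos.2 hc2
  have hC : 0 ≤ C := (abs_nonneg _).trans (h0 0)
  have hbd : ∀ (u : ℝ →ᵇ ℝ) t, ‖G t (u t)‖ ≤ L * ‖u‖ + C := by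
    intro u t
    have e1 := hlip t (u t) 0
    have e2 := h0 t
    have e3 := u.norm_coe_le_norm t
    rw [Real.norm_eq_abs] at e3 ⊢
    rw [sub_zero] at e1
    have e4 : |G t (u t)| ≤ |G t (u t) - G t 0| + |G t 0| := by
      simpa using abs_add_le (G t (u t) - G t 0) (G t 0)
    nlinarith [mul_le_mul_of_nonneg_left e3 hL]
  let N : (ℝ →ᵇ ℝ) → (ℝ →ᵇ ℝ) := fun u =>
    BoundedContinuousFunction.ofNormedAddCommGroup (fun t => G t (u t))
      (hG.comp (continuous_id.prodMk u.continuous)) (L * ‖u‖ + C) (hbd u)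
  have hN : ∀ u u', ‖N u - N u'‖ ≤ L * ‖u - u'‖ := by
    intro u u'
    refine (BoundedContinuousFunction.norm_le (by positivity)).2 (fun t => ?_)
    refine (hlip t (u t) (u' t)).trans ?_
    exact mul_le_mul_of_nonneg_left ((u - u').norm_coe_le_norm t) hL
  have hN0 : ∀ u, ‖N u‖ ≤ L * ‖u‖ + C := fun u =>
    (BoundedContinuousFunction.norm_le (by positivity)).2 (hbd u)
  have hk : 0 ≤ L / (|c1| * |c2|) := by positivity
  obtain ⟨k, hkk⟩ : ∃ k : NNReal, (k : ℝ) = L / (|c1| * |c2|) := ⟨Real.toNNReal _, Real.coe_toNNReal _ hk⟩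
  have hcontr : ContractingWith k (fun u => S2 (S1 (N u))) := by
    constructor
    · rw [← NNReal.coe_lt_coe]
      rw [hkk, NNReal.coe_one, div_lt_one (by positivity)]
      exact hLc
    · refine LipschitzWith.of_dist_le_mul (fun u u' => ?_)
      rw [dist_eq_norm, dist_eq_norm]
      refine (b2 _ _).trans ?_
      calc _ ≤ (‖N u - N u'‖ / |c1|) / |c2| := by gcongr; exact a2 _ _
        _ ≤ ((L * ‖u - u'‖) / |c1|) / |c2| := by gcongr; exact hN _ _
        _ = _ := by rw [hkk]; field_simp
  have hfix := hcontr.fixedPoint_isFixedPt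
  set u := ContractingWith.fixedPoint _ hcontr with hu
  have hfix' : S2 (S1 (N u)) = u := hfix
  refine ⟨u, S1 (N u), fun t => ?_, fun t => ?_, fun t => ?_⟩
  · have := b1 (S1 (N u)) t
    rwa [hfix'] at this
  · exact a1 (N u) t
  · have e1 : ‖u‖ ≤ ((L * ‖u‖ + C) / |c1|) / |c2| := by
      calc ‖u‖ = ‖S2 (S1 (N u))‖ := by rw [hfix']
        _ ≤ ‖S1 (N u)‖ / |c2| := b3 _
        _ ≤ (‖N u‖ / |c1|) / |c2| := by gcongr; exact a3 _
        _ ≤ _ := by gcongr; exact hN0 _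
    rw [div_div, le_div_iff₀ (by positivity)] at e1
    have e2 := u.norm_coe_le_norm t
    rw [Real.norm_eq_abs] at e2
    nlinarith [mul_le_mul_of_nonneg_right e2 (sub_nonneg.2 hLc.le)]

lemma barbalat {Φ φ e : ℝ → ℝ} {a K : ℝ} (hΦ : Tendsto Φ atTop (𝓝 a))
    (hd : ∀ t, HasDerivAt Φ (φ t + e t) t) (he : Tendsto e atTop (𝓝 0)) (hK : 0 ≤ K)
    (hφ : ∀ s t, 0 ≤ s → s ≤ t → |φ t - φ s| ≤ K * (t - s)) : Tendsto φ atTop (𝓝 0) := by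
  rw [Metric.tendsto_atTop]
  intro ε hε
  set δ : ℝ := ε / (4 * (K + 1)) with hδ
  have hδ0 : 0 < δ := by positivity
  have hKδ : K * δ ≤ ε / 4 := by
    have : (K + 1) * δ = ε / 4 := by rw [hδ]; field_simp
    nlinarith
  obtain ⟨N1, hN1⟩ := (Metric.tendsto_atTop.1 hΦ) (δ * ε / 8) (by positivity)
  obtain ⟨N2, hN2⟩ := (Metric.tendsto_atTop.1 he) (ε / 4) (by positivity)
  refine ⟨max (max N1 N2) 0, fun t ht => ?_⟩
  have ht1 : N1 ≤ t := (le_max_left _ _).trans ((le_max_left _ _).trans ht)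
  have ht2 : N2 ≤ t := (le_max_right _ _).trans ((le_max_left _ _).trans ht)
  have ht0 : 0 ≤ t := (le_max_right _ _).trans ht
  obtain ⟨ξ, hξ, hs⟩ := exists_hasDerivAt_eq_slope Φ (fun t => φ t + e t) (a := t) (b := t + δ)
    (by linarith) (fun x _ => (hd x).continuousAt.continuousWithinAt) (fun x _ => hd x)
  have q1 := hN1 t ht1
  have q2 := hN1 (t + δ) (by linarith)
  have q3 := hN2 ξ (by linarith [hξ.1])
  have q4 := hφ t ξ ht0 hξ.1.le
  rw [Real.dist_eq] at *
  rw [sub_zero] at *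
  rw [add_sub_cancel_left, eq_div_iff hδ0.ne'] at hs
  rw [abs_lt] at q1 q2 q3
  have q5 : K * (ξ - t) ≤ K * δ := mul_le_mul_of_nonneg_left (by linarith [hξ.2]) hK
  have q6 := abs_le.1 (q4.trans (q5.trans hKδ))
  have q7 : φ ξ + e ξ < ε / 4 := by
    by_contra hcon
    push Not at hcon
    nlinarith [mul_le_mul_of_nonneg_right hcon hδ0.le]
  have q8 : -(ε / 4) < φ ξ + e ξ := by
    by_contra hcon
    push Not at hcon
    nlinarith [mul_le_mul_of_nonneg_right hcon hδ0.le]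
  rw [abs_lt]
  constructor <;> linarith [q6.1, q6.2, q3.1, q3.2]

lemma lim_of_sin {x : ℝ → ℝ} (hx : Continuous x) (hs : Tendsto (fun t => Real.sin (x t)) atTop (𝓝 0)) :
    ∃ m : ℤ, Tendsto x atTop (𝓝 (m * π)) := by
  obtain ⟨T, hT⟩ := (Metric.tendsto_atTop.1 hs) 1 one_pos
  have hpi := Real.pi_pos
  have hlt : ∀ t, T ≤ t → |Real.sin (x t)| < 1 := by
    intro t ht
    have := hT t ht
    rwa [Real.dist_eq, sub_zero] at this
  set m : ℤ := round (x T / π) with hm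
  have hsin : ∀ t, |Real.sin (x t - m * π)| = |Real.sin (x t)| := by
    intro t
    rw [Real.sin_sub_int_mul_pi, abs_mul]
    simp
  have hne : ∀ t, T ≤ t → |x t - m * π| ≠ π / 2 := by
    intro t ht h
    have h1 := hlt t ht
    rw [← hsin] at h1
    rcases (abs_eq (by positivity)).1 h with h | h <;> rw [h] at h1 <;> simp at h1
  have hinit : |x T - m * π| < π / 2 := by
    refine lt_of_le_of_ne ?_ (hne T le_rfl)
    have h1 := abs_sub_round (x T / π)
    rw [← hm] at h1
    have h2 : x T - m * π = (x T / π - m) * π := by field_simp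
    rw [h2, abs_mul, abs_of_pos hpi]
    nlinarith
  have hall : ∀ t, T ≤ t → |x t - m * π| < π / 2 := by
    intro t ht
    by_contra hcon
    push Not at hcon
    have hc : ContinuousOn (fun s => |x s - m * π|) (Icc T t) := by fun_prop
    obtain ⟨s, hs1, hs2⟩ := intermediate_value_Icc ht hc ⟨hinit.le, hcon⟩
    exact hne s hs1.1 hs2
  refine ⟨m, ?_⟩
  have h1 : Tendsto (fun t => Real.sin (x t - m * π)) atTop (𝓝 0) := by
    rw [tendsto_zero_iff_abs_tendsto_zero] at hs ⊢
    refine hs.congr (fun t => ?_)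
    exact (hsin t).symm
  have h2 : Tendsto (fun t => Real.arcsin (Real.sin (x t - m * π))) atTop (𝓝 0) := by
    have := (Real.continuous_arcsin.tendsto 0).comp h1
    rwa [Real.arcsin_zero] at this
  have h3 : Tendsto (fun t => x t - m * π) atTop (𝓝 0) := by
    refine h2.congr' ?_
    filter_upwards [eventually_ge_atTop T] with t ht
    have := abs_lt.1 (hall t ht)
    exact Real.arcsin_sin this.1.le this.2.le
  simpa using h3.add_const (m * π)

lemma z_upper {z g : ℝ → ℝ} {B : ℝ} (hz : ∀ t, HasDerivAt z (-(z t) + g t) t)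
    (hg : ∀ t, g t ≤ B) (hB : 0 ≤ B) : ∀ t, 0 ≤ t → z t ≤ |z 0| + B := by
  intro t ht
  have h : ∀ s, HasDerivAt (fun s => Real.exp s * (z s - B)) (Real.exp s * (g s - B)) s := by
    intro s
    refine ((Real.hasDerivAt_exp s).mul ((hz s).sub_const B)).congr_deriv ?_
    ring
  have hanti : Antitone (fun s => Real.exp s * (z s - B)) :=
    antitone_of_hasDerivAt_nonpos h
      (fun s => mul_nonpos_of_nonneg_of_nonpos (Real.exp_pos s).le (by linarith [hg s]))
  have h1 := hanti ht
  simp only [Real.exp_zero, one_mul] at h1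
  by_contra hcon
  push Not at hcon
  have h2 : z t - B > |z 0| := by linarith
  have h3 : 1 ≤ Real.exp t := Real.one_le_exp ht
  have h4 := le_abs_self (z 0)
  have h5 := abs_nonneg (z 0)
  rcases hB.lt_or_eq with hB | hB
  · nlinarith
  · nlinarith

/-- Convergence at `+∞`. -/
lemma conv_top {y z ρ : ℝ → ℝ} {W α C T1 B : ℝ} (hα : 0 < α)
    (hy : ∀ t, HasDerivAt y (z t) t)
    (hz : ∀ t, HasDerivAt z (-(z t) - 2 * (W * Real.cos (y t) - Real.sin (y t)) - ρ t) t)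
    (hB : ∀ t, |ρ t| ≤ B)
    (hρ : ∀ t, T1 ≤ t → |ρ t| ≤ C * Real.exp (-α * t)) :
    ∃ m : ℤ, Tendsto y atTop (𝓝 (Real.arctan W + m * π)) := by
  have hB0 : 0 ≤ B := (abs_nonneg _).trans (hB 0)
  have hC : 0 ≤ C := by
    have := (abs_nonneg _).trans (hρ T1 le_rfl)
    exact nonneg_of_mul_nonneg_left this (Real.exp_pos _)
  have hfb : ∀ s, |2 * (W * Real.cos s - Real.sin s)| ≤ 2 * (|W| + 1) := by
    intro s
    rw [abs_mul, abs_two]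
    have h1 : |W * Real.cos s| ≤ |W| := by
      rw [abs_mul]; exact mul_le_of_le_one_right (abs_nonneg _) (Real.abs_cos_le_one s)
    have h2 := Real.abs_sin_le_one s
    have h3 := abs_sub (W * Real.cos s) (Real.sin s)
    linarith
  set B' := 2 * (|W| + 1) + B with hB'
  have hB'0 : 0 ≤ B' := by positivity
  set M := |z 0| + B' with hM
  have hM0 : 0 ≤ M := by positivity
  have hzM : ∀ t, 0 ≤ t → |z t| ≤ M := by
    intro t ht
    rw [abs_le]
    constructor
    · have := z_upper (z := fun t => - z t)
        (g := fun t => 2 * (W * Real.cos (y t) - Real.sin (y t)) + ρ t) (B := B')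
        (fun t => ((hz t).neg).congr_deriv (by ring))
        (fun t => by linarith [(abs_le.1 (hfb (y t))).2, (abs_le.1 (hB t)).2]) hB'0 t ht
      simp only [abs_neg] at this
      linarith
    · exact z_upper (z := z)
        (g := fun t => - 2 * (W * Real.cos (y t) - Real.sin (y t)) - ρ t) (B := B')
        (fun t => (hz t).congr_deriv (by ring))
        (fun t => by linarith [(abs_le.1 (hfb (y t))).1, (abs_le.1 (hB t)).1]) hB'0 t ht
  have hzlip : ∀ s t, 0 ≤ s → s ≤ t → |z t - z s| ≤ (M + B') * (t - s) := by
    intro s t hs hst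
    have := Convex.norm_image_sub_le_of_norm_hasDerivWithin_le (f := z) (s := Ici 0) (x := s)
      (y := t) (C := M + B') (fun x _ => (hz x).hasDerivWithinAt) (fun x hx => by
        rw [Real.norm_eq_abs, abs_le]
        have q1 := abs_le.1 (hzM x hx)
        have q2 := abs_le.1 (hfb (y x))
        have q3 := abs_le.1 (hB x)
        constructor <;> linarith [q1.1, q1.2, q2.1, q2.2, q3.1, q3.2])
      (convex_Ici 0) hs (hs.trans hst)
    rw [Real.norm_eq_abs, Real.norm_eq_abs, abs_of_nonneg (sub_nonneg.2 hst)] at this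
    exact this
  have hylip : ∀ s t, 0 ≤ s → s ≤ t → |y t - y s| ≤ M * (t - s) := by
    intro s t hs hst
    have := Convex.norm_image_sub_le_of_norm_hasDerivWithin_le (f := y) (s := Ici 0) (x := s)
      (y := t) (C := M) (fun x _ => (hy x).hasDerivWithinAt) (fun x hx => hzM x hx)
      (convex_Ici 0) hs (hs.trans hst)
    rw [Real.norm_eq_abs, Real.norm_eq_abs, abs_of_nonneg (sub_nonneg.2 hst)] at this
    exact this
  have hexp0 : Tendsto (fun t => Real.exp (-α * t)) atTop (𝓝 0) := by
    refine Real.tendsto_exp_atBot.comp ?_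
    exact tendsto_id.const_mul_atTop_of_neg (by linarith)
  have hρ0 : Tendsto ρ atTop (𝓝 0) := by
    have h1 : Tendsto (fun t => C * Real.exp (-α * t)) atTop (𝓝 0) := by
      simpa using hexp0.const_mul C
    refine squeeze_zero_norm' ?_ h1
    filter_upwards [eventually_ge_atTop T1] with t ht using hρ t ht
  -- energy
  set E : ℝ → ℝ := fun t => z t ^ 2 / 2 + 2 * (W * Real.sin (y t) + Real.cos (y t)) with hE
  have hEd : ∀ t, HasDerivAt E (-(z t) ^ 2 + (- ρ t * z t)) t := by
    intro t
    have h1 := ((hz t).pow 2).div_const 2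
    have h2 := (((hy t).sin.const_mul W).add (hy t).cos).const_mul 2
    refine (h1.add h2).congr_deriv ?_
    push_cast
    ring
  set T2 := max T1 0 with hT2
  set D := M * C / α with hD
  have hEtd : ∀ t, HasDerivAt (fun t => E t + D * Real.exp (-α * t))
      ((-(z t) ^ 2 + (- ρ t * z t)) - M * C * Real.exp (-α * t)) t := by
    intro t
    have h3 : HasDerivAt (fun x => Real.exp (-α * x)) (Real.exp (-α * t) * (-α)) t := by
      simpa using ((hasDerivAt_id t).const_mul (-α)).exp
    refine ((hEd t).add (h3.const_mul D)).congr_deriv ?_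
    rw [hD]; field_simp; ring
  have hanti : AntitoneOn (fun t => E t + D * Real.exp (-α * t)) (Ici T2) := by
    refine antitoneOn_of_deriv_nonpos (convex_Ici _)
      (fun t _ => (hEtd t).continuousAt.continuousWithinAt)
      (fun t _ => (hEtd t).differentiableAt.differentiableWithinAt) (fun t ht => ?_)
    rw [interior_Ici, mem_Ioi] at ht
    rw [(hEtd t).deriv]
    have q1 := hzM t ((le_max_right _ _).trans ht.le)
    have q2 := hρ t ((le_max_left _ _).trans ht.le)
    have q3 : -ρ t * z t ≤ M * (C * Real.exp (-α * t)) := by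
      calc -ρ t * z t ≤ |-ρ t * z t| := le_abs_self _
        _ = |z t| * |ρ t| := by rw [abs_mul, abs_neg, mul_comm]
        _ ≤ _ := mul_le_mul q1 q2 (abs_nonneg _) hM0
    nlinarith [sq_nonneg (z t)]
  obtain ⟨a, ha⟩ : ∃ a, Tendsto E atTop (𝓝 a) := by
    have hA : Antitone (fun t => E (max t T2) + D * Real.exp (-α * (max t T2))) := by
      intro s t hst
      exact hanti (mem_Ici.2 (le_max_right _ _)) (mem_Ici.2 (le_max_right _ _)) (max_le_max_right _ hst)
    have hbdd : BddBelow (range (fun t => E (max t T2) + D * Real.exp (-α * (max t T2)))) := by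
      refine ⟨-(2 * (|W| + 1)), ?_⟩
      rintro _ ⟨t, rfl⟩
      have e1 : 0 ≤ D * Real.exp (-α * (max t T2)) := by positivity
      have e2 : -(|W| + 1) ≤ W * Real.sin (y (max t T2)) + Real.cos (y (max t T2)) := by
        have h1 : |W * Real.sin (y (max t T2))| ≤ |W| := by
          rw [abs_mul]; exact mul_le_of_le_one_right (abs_nonneg _) (Real.abs_sin_le_one _)
        linarith [(abs_le.1 h1).1, Real.neg_one_le_cos (y (max t T2))]
      simp only [hE]
      nlinarith [sq_nonneg (z (max t T2))]
    have h1 := tendsto_atTop_ciInf hA hbdd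
    have h2 := h1.sub (hexp0.const_mul D)
    refine ⟨_, h2.congr' ?_⟩
    filter_upwards [eventually_ge_atTop T2] with t ht
    rw [max_eq_left ht]
    ring
  have hρz : Tendsto (fun t => -ρ t * z t) atTop (𝓝 0) := by
    have h1 : Tendsto (fun t => |ρ t| * M) atTop (𝓝 0) := by
      simpa using ((tendsto_zero_iff_abs_tendsto_zero _).1 hρ0).mul_const M
    refine squeeze_zero_norm' ?_ h1
    filter_upwards [eventually_ge_atTop 0] with t ht
    rw [Real.norm_eq_abs, abs_mul, abs_neg]
    exact mul_le_mul_of_nonneg_left (hzM t ht) (abs_nonneg _)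
  have hz2 : Tendsto (fun t => -(z t) ^ 2) atTop (𝓝 0) := by
    refine barbalat ha hEd hρz (K := (2 * M) * (M + B')) (by positivity) ?_
    intro s t hs hst
    have e1 : -(z t) ^ 2 - -(z s) ^ 2 = -((z t + z s) * (z t - z s)) := by ring
    rw [e1, abs_neg, abs_mul]
    have e2 : |z t + z s| ≤ 2 * M := by
      linarith [abs_add_le (z t) (z s), hzM t (hs.trans hst), hzM s hs]
    calc _ ≤ (2 * M) * ((M + B') * (t - s)) :=
          mul_le_mul e2 (hzlip s t hs hst) (abs_nonneg _) (by positivity)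
      _ = _ := by ring
  have hz0 : Tendsto z atTop (𝓝 0) := by
    have h1 : Tendsto (fun t => (z t) ^ 2) atTop (𝓝 0) := by simpa using hz2.neg
    have h2 := (Real.continuous_sqrt.tendsto 0).comp h1
    rw [tendsto_zero_iff_abs_tendsto_zero]
    refine (h2.congr (fun t => ?_)).trans (by simp)
    simp [Real.sqrt_sq_eq_abs]
  have hf0 : Tendsto (fun t => -(2 * (W * Real.cos (y t) - Real.sin (y t)))) atTop (𝓝 0) := by
    refine barbalat hz0 (e := fun t => - z t - ρ t)
      (fun t => (hz t).congr_deriv (by ring)) (by simpa using hz0.neg.sub hρ0)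
      (K := 2 * (|W| + 1) * M) (by positivity) ?_
    intro s t hs hst
    have e1 := Real.abs_cos_sub_cos_le (y t) (y s)
    have e2 := Real.abs_sin_sub_sin_le (y t) (y s)
    have e3 : -(2 * (W * Real.cos (y t) - Real.sin (y t))) - -(2 * (W * Real.cos (y s) - Real.sin (y s)))
      = 2 * ((Real.sin (y t) - Real.sin (y s)) - W * (Real.cos (y t) - Real.cos (y s))) := by ring
    rw [e3, abs_mul, abs_two]
    have e4 := abs_sub (Real.sin (y t) - Real.sin (y s)) (W * (Real.cos (y t) - Real.cos (y s)))
    rw [abs_mul] at e4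
    have e5 := mul_le_mul_of_nonneg_left e1 (abs_nonneg W)
    have e6 := mul_le_mul_of_nonneg_left (hylip s t hs hst) (by positivity : 0 ≤ |W| + 1)
    nlinarith
  have hsin : Tendsto (fun t => Real.sin (y t - Real.arctan W)) atTop (𝓝 0) := by
    have h1 := hf0.mul_const (1 / (2 * √(1 + W ^ 2)))
    rw [zero_mul] at h1
    refine h1.congr (fun t => ?_)
    rw [Real.sin_sub, Real.sin_arctan, Real.cos_arctan]
    have : 0 < √(1 + W ^ 2) := Real.sqrt_pos.2 (by positivity)
    field_simp
    ring
  have hyc : Continuous y := continuous_iff_continuousAt.2 fun t => (hy t).continuousAt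
  obtain ⟨m, hm⟩ := lim_of_sin (x := fun t => y t - Real.arctan W) (by fun_prop) hsin
  refine ⟨m, ?_⟩
  have := hm.const_add (Real.arctan W)
  simpa using this

lemma weighted_solution {a b γ L C : ℝ} (hc1 : γ + a ≠ 0) (hc2 : γ + b ≠ 0) (hL : 0 ≤ L)
    (hLc : L < |γ + a| * |γ + b|) (g : ℝ → ℝ → ℝ) (hg : Continuous (Function.uncurry g))
    (hlip : ∀ t x x', |g t x - g t x'| ≤ L * |x - x'|)
    (h0 : ∀ t, |g t 0| ≤ C * Real.exp (γ * t)) :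
    ∃ y z : ℝ → ℝ, (∀ t, HasDerivAt y (z t) t) ∧
      (∀ t, HasDerivAt z (-(a + b) * z t - a * b * y t + g t (y t)) t) ∧
      (∀ t, |y t| * (|γ + a| * |γ + b| - L) ≤ C * Real.exp (γ * t)) := by
  have hee : ∀ t, Real.exp (γ * t) * Real.exp (-(γ * t)) = 1 := by
    intro t; rw [← Real.exp_add]; simp
  obtain ⟨u, v, hu, hv, hb⟩ := fixed_solution hc1 hc2 hL hLc (C := C)
    (fun t x => Real.exp (-(γ * t)) * g t (Real.exp (γ * t) * x))
    (by
      have h1 : Continuous (fun p : ℝ × ℝ => (p.1, Real.exp (γ * p.1) * p.2)) := by fun_prop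
      have h2 := hg.comp h1
      have h3 : Continuous (fun p : ℝ × ℝ => Real.exp (-(γ * p.1))) := by fun_prop
      exact h3.mul h2)
    (by
      intro t x x'
      rw [← mul_sub, abs_mul, abs_of_pos (Real.exp_pos _)]
      have h1 := hlip t (Real.exp (γ * t) * x) (Real.exp (γ * t) * x')
      rw [← mul_sub, abs_mul, abs_of_pos (Real.exp_pos _)] at h1
      calc _ ≤ Real.exp (-(γ * t)) * (L * (Real.exp (γ * t) * |x - x'|)) :=
            mul_le_mul_of_nonneg_left h1 (Real.exp_pos _).le
        _ = (Real.exp (γ * t) * Real.exp (-(γ * t))) * (L * |x - x'|) := by ring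
        _ = _ := by rw [hee, one_mul])
    (by
      intro t
      rw [mul_zero, abs_mul, abs_of_pos (Real.exp_pos _)]
      calc _ ≤ Real.exp (-(γ * t)) * (C * Real.exp (γ * t)) :=
            mul_le_mul_of_nonneg_left (h0 t) (Real.exp_pos _).le
        _ = (Real.exp (γ * t) * Real.exp (-(γ * t))) * C := by ring
        _ = _ := by rw [hee, one_mul])
  have hed : ∀ t, HasDerivAt (fun x => Real.exp (γ * x)) (Real.exp (γ * t) * γ) t := by
    intro t
    simpa using ((hasDerivAt_id t).const_mul γ).exp
  refine ⟨fun t => Real.exp (γ * t) * u t, fun t => Real.exp (γ * t) * (v t - b * u t),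
    fun t => ?_, fun t => ?_, fun t => ?_⟩
  · refine ((hed t).mul (hu t)).congr_deriv ?_
    ring
  · refine ((hed t).mul ((hv t).sub ((hu t).const_mul b))).congr_deriv ?_
    simp only [Pi.sub_apply]
    linear_combination (g t (Real.exp (γ * t) * u t)) * hee t
  · rw [abs_mul, abs_of_pos (Real.exp_pos _)]
    calc _ = Real.exp (γ * t) * (|u t| * (|γ + a| * |γ + b| - L)) := by ring
      _ ≤ Real.exp (γ * t) * C := mul_le_mul_of_nonneg_left (hb t) (Real.exp_pos _).le
      _ = _ := mul_comm _ _

noncomputable def FF (w A Q y : ℝ) : ℝ :=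
  2 * (w * Real.cos (y + w) - Real.sin (y + w)) + (A * (Real.cos (y + w) - 1) - Q * Real.sin (y + w))

lemma FF_lip (w A Q x y : ℝ) : |FF w A Q x - FF w A Q y| ≤ (2 * |w| + 2 + |A| + |Q|) * |x - y| := by
  have c1 := Real.abs_cos_sub_cos_le (x + w) (y + w)
  have s1 := Real.abs_sin_sub_sin_le (x + w) (y + w)
  rw [add_sub_add_right_eq_sub] at c1 s1
  have e : FF w A Q x - FF w A Q y = (2 * w + A) * (Real.cos (x + w) - Real.cos (y + w))
      + (-2 - Q) * (Real.sin (x + w) - Real.sin (y + w)) := by unfold FF; ring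
  rw [e]
  refine (abs_add_le _ _).trans ?_
  rw [abs_mul, abs_mul]
  have a1 : |2 * w + A| ≤ 2 * |w| + |A| := by
    refine (abs_add_le _ _).trans ?_
    rw [abs_mul, abs_two]
  have a2 : |-2 - Q| ≤ 2 + |Q| := by
    refine (abs_sub _ _).trans ?_
    simp
  have b1 := mul_le_mul a1 c1 (abs_nonneg _) (by positivity)
  have b2 := mul_le_mul a2 s1 (abs_nonneg _) (by positivity)
  nlinarith

lemma FF_bound (w A Q x : ℝ) : |FF w A Q x| ≤ 2 * |w| + 2 + 2 * |A| + |Q| := by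
  unfold FF
  have c1 := Real.abs_cos_le_one (x + w)
  have s1 := Real.abs_sin_le_one (x + w)
  have b1 : |w * Real.cos (x + w)| ≤ |w| := by
    rw [abs_mul]; exact mul_le_of_le_one_right (abs_nonneg _) c1
  have b2 : |Q * Real.sin (x + w)| ≤ |Q| := by
    rw [abs_mul]; exact mul_le_of_le_one_right (abs_nonneg _) s1
  have b3 : |A * (Real.cos (x + w) - 1)| ≤ 2 * |A| := by
    rw [abs_mul, mul_comm]
    refine mul_le_mul_of_nonneg_right ?_ (abs_nonneg _)
    rw [abs_le] at c1 ⊢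
    constructor <;> linarith [c1.1, c1.2]
  rw [abs_le] at *
  constructor <;> linarith [s1.1, s1.2, b1.1, b1.2, b2.1, b2.2, b3.1, b3.2]

lemma sin_sub_id_lip {a b : ℝ} (ha : |a| ≤ 1 / 2) (hb : |b| ≤ 1 / 2) :
    |(Real.sin a - a) - (Real.sin b - b)| ≤ 1 / 8 * |a - b| := by
  have := Convex.norm_image_sub_le_of_norm_hasDerivWithin_le (f := fun x => Real.sin x - x)
    (f' := fun x => Real.cos x - 1)
    (s := Icc (-(1/2)) (1/2)) (x := b) (y := a) (C := 1 / 8)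
    (fun x _ => ((Real.hasDerivAt_sin x).sub (hasDerivAt_id x)).hasDerivWithinAt)
    (fun x hx => by
      rw [Real.norm_eq_abs, abs_le]
      have h1 := Real.one_sub_sq_div_two_le_cos (x := x)
      have h2 := Real.cos_le_one x
      have h3 : x ^ 2 ≤ 1 / 4 := by nlinarith [hx.1, hx.2]
      constructor <;> linarith) (convex_Icc _ _) (abs_le.1 hb) (abs_le.1 ha)
  exact this

lemma kk_lip {w A Q x y : ℝ} (hw : |w| ≤ 1 / 16) (hA : |A| ≤ 1 / 16) (hQ : |Q| ≤ 1 / 16)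
    (hx : |x| ≤ 1 / 4) (hy : |y| ≤ 1 / 4) :
    |(-FF w A Q x - 2 * x) - (-FF w A Q y - 2 * y)| ≤ 1 / 2 * |x - y| := by
  have c1 := Real.abs_cos_sub_cos_le (x + w) (y + w)
  have s1 := Real.abs_sin_sub_sin_le (x + w) (y + w)
  have d1 := sin_sub_id_lip (a := x + w) (b := y + w)
    ((abs_add_le _ _).trans (by linarith)) ((abs_add_le _ _).trans (by linarith))
  rw [add_sub_add_right_eq_sub] at c1 s1 d1
  have e : (-FF w A Q x - 2 * x) - (-FF w A Q y - 2 * y)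
      = 2 * (Real.sin (x + w) - (x + w) - (Real.sin (y + w) - (y + w)))
        + -(2 * w + A) * (Real.cos (x + w) - Real.cos (y + w))
        + Q * (Real.sin (x + w) - Real.sin (y + w)) := by unfold FF; ring
  rw [e]
  refine (abs_add_three _ _ _).trans ?_
  rw [abs_mul, abs_mul, abs_mul, abs_two]
  have a1 : |-(2 * w + A)| ≤ 3 / 16 := by
    rw [abs_neg]
    refine (abs_add_le _ _).trans ?_
    rw [abs_mul, abs_two]
    linarith
  have b1 := mul_le_mul a1 c1 (abs_nonneg _) (by positivity)
  have b2 := mul_le_mul hQ s1 (abs_nonneg _) (by positivity)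
  nlinarith

lemma kk_zero (w A Q : ℝ) : |-FF w A Q 0 - 2 * 0| ≤ 4 * |w| + 2 * |A| + |Q| := by
  have c1 := Real.abs_cos_le_one w
  have s1 := Real.abs_sin_le_one w
  have s2 : |Real.sin w| ≤ |w| := Real.abs_sin_le_abs
  have b1 : |w * Real.cos w| ≤ |w| := by
    rw [abs_mul]; exact mul_le_of_le_one_right (abs_nonneg _) c1
  have b2 : |Q * Real.sin w| ≤ |Q| := by
    rw [abs_mul]; exact mul_le_of_le_one_right (abs_nonneg _) s1
  have b3 : |A * (Real.cos w - 1)| ≤ 2 * |A| := by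
    rw [abs_mul, mul_comm]
    refine mul_le_mul_of_nonneg_right ?_ (abs_nonneg _)
    rw [abs_le] at c1 ⊢
    constructor <;> linarith [c1.1, c1.2]
  unfold FF
  rw [zero_add]
  rw [abs_le] at b1 b2 b3 s2 ⊢
  constructor <;> linarith [s2.1, s2.2, b1.1, b1.2, b2.1, b2.2, b3.1, b3.2]

lemma exists_unstable {w A Q : ℝ → ℝ} (hw : Continuous w) (hA : Continuous A) (hQ : Continuous Q)
    {γ T : ℝ} (hγ : 0 < γ) (hγ' : γ ≤ 1 / 2) (hT : Real.exp (γ * T) ≤ 1 / 4)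
    (bw : ∀ t, t ≤ T → |w t| ≤ 1 / 16 * Real.exp (γ * t))
    (bA : ∀ t, t ≤ T → |A t| ≤ 1 / 16 * Real.exp (γ * t))
    (bQ : ∀ t, t ≤ T → |Q t| ≤ 1 / 16 * Real.exp (γ * t)) :
    ∃ y z h : ℝ → ℝ, Continuous h ∧ (∀ t, HasDerivAt y (z t) t) ∧
      (∀ t, HasDerivAt z (-(z t) + h t) t) ∧
      (∀ t, t ≤ T → h t = - FF (w t) (A t) (Q t) (y t)) ∧
      (∀ t, |y t| ≤ Real.exp (γ * t)) ∧ (∀ t, |h t| ≤ 4 * Real.exp (γ * t)) := by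
  have h14 : (-(1/4) : ℝ) ≤ 1 / 4 := by norm_num
  let κ : ℝ → ℝ := fun y => (projIcc (-(1/4) : ℝ) (1/4) h14 y : ℝ)
  have hκc : Continuous κ := continuous_subtype_val.comp continuous_projIcc
  have hκb : ∀ y, |κ y| ≤ 1 / 4 := fun y => abs_le.2 (projIcc (-(1/4) : ℝ) (1/4) h14 y).2
  have hκl : ∀ x y, |κ x - κ y| ≤ |x - y| := fun x y => abs_projIcc_sub_projIcc h14
  have hκi : ∀ y, |y| ≤ 1 / 4 → κ y = y := fun y hy => by
    simp only [κ]
    rw [projIcc_of_mem h14 (abs_le.1 hy)]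
  let g : ℝ → ℝ → ℝ := fun t y =>
    -FF (w (min t T)) (A (min t T)) (Q (min t T)) (κ y) - 2 * κ y
  have hgc : Continuous (Function.uncurry g) := by
    simp only [g, Function.uncurry_def, FF]
    fun_prop
  have hexpT : ∀ t, Real.exp (γ * min t T) ≤ 1 / 4 := fun t =>
    (Real.exp_le_exp.2 (mul_le_mul_of_nonneg_left (min_le_right t T) hγ.le)).trans hT
  have hexpt : ∀ t, Real.exp (γ * min t T) ≤ Real.exp (γ * t) := fun t =>
    (Real.exp_le_exp.2 (mul_le_mul_of_nonneg_left (min_le_left t T) hγ.le))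
  have hlip : ∀ t x x', |g t x - g t x'| ≤ 1 / 2 * |x - x'| := by
    intro t x x'
    have q1 := bw (min t T) (min_le_right _ _)
    have q2 := bA (min t T) (min_le_right _ _)
    have q3 := bQ (min t T) (min_le_right _ _)
    have q4 := hexpT t
    have := kk_lip (w := w (min t T)) (A := A (min t T)) (Q := Q (min t T)) (by linarith)
      (by linarith) (by linarith) (hκb x) (hκb x')
    exact this.trans (mul_le_mul_of_nonneg_left (hκl x x') (by norm_num))
  have hg0 : ∀ t, |g t 0| ≤ 1 / 2 * Real.exp (γ * t) := by
    intro t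
    have q1 := bw (min t T) (min_le_right _ _)
    have q2 := bA (min t T) (min_le_right _ _)
    have q3 := bQ (min t T) (min_le_right _ _)
    have q4 := hexpt t
    have q5 := Real.exp_pos (γ * min t T)
    have := kk_zero (w (min t T)) (A (min t T)) (Q (min t T))
    have e0 : κ 0 = 0 := hκi 0 (by norm_num)
    simp only [g, e0]
    refine le_trans this ?_
    linarith
  have ha1 : |γ + 2| = γ + 2 := abs_of_pos (by linarith)
  have ha2 : |γ + -1| = 1 - γ := by rw [abs_of_neg (by linarith)]; ring
  have hprod : 1 ≤ |γ + 2| * |γ + -1| := by rw [ha1, ha2]; nlinarith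
  obtain ⟨y, z, hy, hz, hb⟩ := weighted_solution (a := 2) (b := -1) (γ := γ) (L := 1 / 2)
    (C := 1 / 2) (by linarith) (by linarith) (by norm_num) (by linarith) g hgc hlip hg0
  have hyb : ∀ t, |y t| ≤ Real.exp (γ * t) := by
    intro t
    have := hb t
    nlinarith [abs_nonneg (y t)]
  have hyc : Continuous y := continuous_iff_continuousAt.2 fun t => (hy t).continuousAt
  refine ⟨y, z, fun t => 2 * y t + g t (y t), ?_, hy, fun t => ?_, fun t ht => ?_, hyb, fun t => ?_⟩
  · exact (hyc.const_mul 2).add (hgc.comp (continuous_id.prodMk hyc))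
  · refine (hz t).congr_deriv ?_
    ring
  · have e1 : κ (y t) = y t := by
      refine hκi _ ((hyb t).trans ?_)
      have := hexpT t
      rwa [min_eq_left ht] at this
    simp only [g, e1, min_eq_left ht]
    ring
  · have q1 := hyb t
    have q2 := hg0 t
    have q3 := hlip t (y t) 0
    rw [sub_zero] at q3
    have q4 := Real.exp_pos (γ * t)
    rw [abs_le] at q1 q2 ⊢
    have q5 : |g t (y t) - g t 0| ≤ 1 / 2 * Real.exp (γ * t) := by
      refine q3.trans (mul_le_mul_of_nonneg_left (hyb t) (by norm_num))
    rw [abs_le] at q5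
    constructor <;> linarith [q1.1, q1.2, q2.1, q2.2, q5.1, q5.2]

lemma exists_global {w A Q : ℝ → ℝ} (hw : Continuous w) (hA : Continuous A) (hQ : Continuous Q)
    {γ T K : ℝ} (hγ : 0 < γ) (hγ' : γ ≤ 1 / 2) (hT : Real.exp (γ * T) ≤ 1 / 4)
    (bw : ∀ t, t ≤ T → |w t| ≤ 1 / 16 * Real.exp (γ * t))
    (bA : ∀ t, t ≤ T → |A t| ≤ 1 / 16 * Real.exp (γ * t))
    (bQ : ∀ t, t ≤ T → |Q t| ≤ 1 / 16 * Real.exp (γ * t))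
    (hK : ∀ t, 2 * |w t| + 2 + 2 * |A t| + |Q t| ≤ K) :
    ∃ y z : ℝ → ℝ, (∀ t, HasDerivAt y (z t) t) ∧
      (∀ t, HasDerivAt z (-(z t) - FF (w t) (A t) (Q t) (y t)) t) ∧
      Tendsto y atBot (𝓝 0) := by
  obtain ⟨y0, z0, h, hh, hy0, hz0, hhT, hy0b, hhb⟩ := exists_unstable hw hA hQ hγ hγ' hT bw bA bQ
  have hK0 : 0 ≤ K := le_trans (by positivity) (hK 0)
  have hyc : Continuous y0 := continuous_iff_continuousAt.2 fun t => (hy0 t).continuousAt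
  set g : ℝ → ℝ → ℝ := fun t x => -FF (w t) (A t) (Q t) (y0 t + x) - h t with hg
  have hgc : Continuous (Function.uncurry g) := by
    simp only [g, Function.uncurry_def, FF]
    fun_prop
  have hlip : ∀ t x x', |g t x - g t x'| ≤ K * |x - x'| := by
    intro t x x'
    have e : g t x - g t x' = -(FF (w t) (A t) (Q t) (y0 t + x) - FF (w t) (A t) (Q t) (y0 t + x')) := by
      simp only [hg]; ring
    rw [e, abs_neg]
    refine (FF_lip _ _ _ _ _).trans ?_
    rw [add_sub_add_left_eq_sub]
    refine mul_le_mul_of_nonneg_right ?_ (abs_nonneg _)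
    linarith [hK t, abs_nonneg (A t)]
  set δ := K + 1 with hδ
  have hg0 : ∀ t, |g t 0| ≤ (K * Real.exp (-(δ * T)) + 4 * Real.exp ((γ - δ) * T)) * Real.exp (δ * t) := by
    intro t
    rcases le_total t T with ht | ht
    · have : g t 0 = 0 := by simp only [hg, add_zero, hhT t ht]; ring
      rw [this, abs_zero]
      positivity
    · have q1 := (FF_bound (w t) (A t) (Q t) (y0 t)).trans (hK t)
      have q2 := hhb t
      have q3 : |g t 0| ≤ K + 4 * Real.exp (γ * t) := by
        simp only [hg, add_zero]
        rw [abs_le] at *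
        constructor <;> linarith [q1.1, q1.2, q2.1, q2.2]
      refine q3.trans ?_
      rw [add_mul, mul_assoc, mul_assoc, ← Real.exp_add, ← Real.exp_add]
      have e1 : 1 ≤ Real.exp (-(δ * T) + δ * t) := Real.one_le_exp (by nlinarith)
      have e2 : Real.exp (γ * t) ≤ Real.exp ((γ - δ) * T + δ * t) := by
        refine Real.exp_le_exp.2 ?_
        nlinarith
      nlinarith
  have ha1 : |δ + 1| = δ + 1 := abs_of_pos (by linarith)
  have ha2 : |δ + 0| = δ := by rw [add_zero]; exact abs_of_pos (by linarith)
  have hLc : K + 1 ≤ |δ + 1| * |δ + 0| := by rw [ha1, ha2]; nlinarith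
  obtain ⟨x, p, hx, hp, hb⟩ := weighted_solution (a := 1) (b := 0) (γ := δ) (L := K)
    (by linarith) (by linarith) hK0 (by linarith) g hgc hlip hg0
  set C := (K * Real.exp (-(δ * T)) + 4 * Real.exp ((γ - δ) * T)) with hC
  refine ⟨fun t => y0 t + x t, fun t => z0 t + p t, fun t => (hy0 t).add (hx t), fun t => ?_, ?_⟩
  · refine ((hz0 t).add (hp t)).congr_deriv ?_
    simp only [hg]
    ring
  · have hexp : ∀ c : ℝ, 0 < c → Tendsto (fun t => Real.exp (c * t)) atBot (𝓝 0) := by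
      intro c hc
      exact Real.tendsto_exp_atBot.comp (tendsto_id.const_mul_atBot hc)
    have t1 : Tendsto y0 atBot (𝓝 0) := squeeze_zero_norm hy0b (hexp γ hγ)
    have t2 : Tendsto x atBot (𝓝 0) := by
      refine squeeze_zero_norm (a := fun t => C * Real.exp (δ * t)) (fun t => ?_) ?_
      · have := hb t
        rw [Real.norm_eq_abs]
        nlinarith [abs_nonneg (x t)]
      · simpa using (hexp δ (by linarith)).const_mul C
    simpa using t1.add t2

lemma FF_diff (w A Q W x : ℝ) (hW : ∃ l : ℤ, W = 2 * l * π) :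
    |FF w A Q x - 2 * (W * Real.cos x - Real.sin x)|
      ≤ (4 + 2 * |W|) * |w - W| + 2 * |A| + |Q| := by
  obtain ⟨l, hl⟩ := hW
  have hc : Real.cos (x + w) = Real.cos (x + (w - W)) := by
    rw [← Real.cos_sub_int_mul_two_pi (x + w) l]; congr 1; rw [hl]; ring
  have hs : Real.sin (x + w) = Real.sin (x + (w - W)) := by
    rw [← Real.sin_sub_int_mul_two_pi (x + w) l]; congr 1; rw [hl]; ring
  have c1 := Real.abs_cos_le_one (x + w)
  have s1 := Real.abs_sin_le_one (x + w)
  have c2 := Real.abs_cos_sub_cos_le (x + (w - W)) x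
  have s2 := Real.abs_sin_sub_sin_le (x + (w - W)) x
  rw [← hc, add_sub_cancel_left] at c2
  rw [← hs, add_sub_cancel_left] at s2
  have b0 : |(w - W) * Real.cos (x + w)| ≤ |w - W| := by
    rw [abs_mul]; exact mul_le_of_le_one_right (abs_nonneg _) c1
  have b1 : |W * (Real.cos (x + w) - Real.cos x)| ≤ |W| * |w - W| := by
    rw [abs_mul]; exact mul_le_mul_of_nonneg_left c2 (abs_nonneg _)
  have b2 : |Q * Real.sin (x + w)| ≤ |Q| := by
    rw [abs_mul]; exact mul_le_of_le_one_right (abs_nonneg _) s1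
  have b3 : |A * (Real.cos (x + w) - 1)| ≤ 2 * |A| := by
    rw [abs_mul, mul_comm]
    refine mul_le_mul_of_nonneg_right ?_ (abs_nonneg _)
    rw [abs_le] at c1 ⊢
    constructor <;> linarith [c1.1, c1.2]
  have e : FF w A Q x - 2 * (W * Real.cos x - Real.sin x) =
      2 * ((w - W) * Real.cos (x + w)) + 2 * (W * (Real.cos (x + w) - Real.cos x))
      - 2 * (Real.sin (x + w) - Real.sin x) + A * (Real.cos (x + w) - 1) - Q * Real.sin (x + w) := by
    unfold FF; ring
  rw [e]
  rw [abs_le] at b0 b1 b2 b3 s2 ⊢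
  constructor <;> nlinarith [s2.1, s2.2, b0.1, b0.2, b1.1, b1.2, b2.1, b2.2, b3.1, b3.2]

lemma bounded_of_limits {f : ℝ → ℝ} (hf : Continuous f) {a b : ℝ} (ha : Tendsto f atBot (𝓝 a))
    (hb : Tendsto f atTop (𝓝 b)) : ∃ K, ∀ t, f t ≤ K := by
  obtain ⟨S, hS⟩ := eventually_atBot.1 (ha.eventually (gt_mem_nhds (lt_add_one a)))
  obtain ⟨T, hT⟩ := eventually_atTop.1 (hb.eventually (gt_mem_nhds (lt_add_one b)))
  obtain ⟨M, hM⟩ := (isCompact_Icc (a := S) (b := T)).bddAbove_image hf.continuousOn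
  refine ⟨max (max (a + 1) (b + 1)) M, fun t => ?_⟩
  rcases le_total t S with h | h
  · exact (hS t h).le.trans ((le_max_left _ _).trans (le_max_left _ _))
  rcases le_total T t with h' | h'
  · exact (hT t h').le.trans ((le_max_right _ _).trans (le_max_left _ _))
  · exact (hM (mem_image_of_mem f ⟨h, h'⟩)).trans (le_max_right _ _)

/-- If `e^{-c t} f → 0` along `l`, then eventually `|f| ≤ ε e^{c t}`. -/
lemma ev_small {f : ℝ → ℝ} {c ε : ℝ} {l : Filter ℝ} (hε : 0 < ε)
    (h : Tendsto (fun t => Real.exp (-c * t) * f t) l (𝓝 0)) :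
    ∀ᶠ t in l, |f t| ≤ ε * Real.exp (c * t) := by
  have h1 := (Metric.tendsto_nhds.1 h) ε hε
  filter_upwards [h1] with t ht
  rw [Real.dist_eq, sub_zero, abs_mul, abs_of_pos (Real.exp_pos _)] at ht
  have he : Real.exp (-c * t) * Real.exp (c * t) = 1 := by rw [← Real.exp_add]; simp
  have := mul_le_mul_of_nonneg_right ht.le (Real.exp_pos (c * t)).le
  calc |f t| = (Real.exp (-c * t) * Real.exp (c * t)) * |f t| := by rw [he, one_mul]
    _ = Real.exp (-c * t) * |f t| * Real.exp (c * t) := by ring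
    _ ≤ _ := this

/-- Theorem 1 of the Appendix: under the stated exponential decay
assumptions on `w`, `T_A`, `T_C` at `±∞`, the equation
`y'' + y' + 2[w cos(y+w) − sin(y+w)] + β e^t[T_A(cos(y+w)−1) − T_C sin(y+w)] = 0`
has a solution on `(−∞,∞)` with `y → 2nπ` at `−∞` and `y → arctan(2ℓπ) + mπ` at `+∞`
for some integers `n, m`. -/
theorem stmt14 (α β : ℝ) (hα : 0 < α) (hβ : 0 < β) (ℓ : ℤ)
    (w TA TC : ℝ → ℝ)
    (hw : ContDiff ℝ 1 w) (hTA : ContDiff ℝ 1 TA) (hTC : ContDiff ℝ 1 TC)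
    (h1 : Tendsto (fun t => Real.exp ((1 - α) * t) * TA t) atBot (nhds 0))
    (h2 : Tendsto (fun t => Real.exp ((1 - α) * t) * TC t) atBot (nhds 0))
    (h3 : Tendsto (fun t => Real.exp (-α * t) * w t) atBot (nhds 0))
    (h4 : Tendsto (fun t => Real.exp ((1 + α) * t) * TA t) atTop (nhds 0))
    (h5 : Tendsto (fun t => Real.exp ((1 + α) * t) * TC t) atTop (nhds 0))
    (h6 : Tendsto (fun t => Real.exp (α * t) * (w t - 2 * (ℓ : ℝ) * π)) atTop (nhds 0))
    (h7 : Tendsto (fun t => Real.exp (α * t) * deriv w t) atTop (nhds 0))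
    (h8 : ∃ LA : ℝ, Tendsto (fun t => Real.exp t * deriv TA t) atTop (nhds LA))
    (h9 : ∃ LC : ℝ, Tendsto (fun t => Real.exp t * deriv TC t) atTop (nhds LC))
    (h10 : ∃ LW : ℝ, Tendsto (fun t => deriv (deriv w) t) atTop (nhds LW)) :
    ∃ y z : ℝ → ℝ,
      (∀ t : ℝ, HasDerivAt y (z t) t) ∧
      (∀ t : ℝ, HasDerivAt z
        (-(z t) - 2 * (w t * Real.cos (y t + w t) - Real.sin (y t + w t))
          - β * Real.exp t * (TA t * (Real.cos (y t + w t) - 1)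
            - TC t * Real.sin (y t + w t))) t) ∧
      ∃ n m : ℤ, Tendsto y atBot (nhds (2 * (n : ℝ) * π)) ∧
        Tendsto y atTop (nhds (Real.arctan (2 * (ℓ : ℝ) * π) + m * π)) := by
  have hwc := hw.continuous
  set A : ℝ → ℝ := fun t => β * Real.exp t * TA t with hAdef
  set Q : ℝ → ℝ := fun t => β * Real.exp t * TC t with hQdef
  have hAc : Continuous A := by have := hTA.continuous; fun_prop
  have hQc : Continuous Q := by have := hTC.continuous; fun_prop
  have conv : ∀ (f : ℝ → ℝ) (c : ℝ) (l : Filter ℝ),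
      Tendsto (fun t => Real.exp ((1 - c) * t) * f t) l (𝓝 0) →
      Tendsto (fun t => Real.exp (-c * t) * (β * Real.exp t * f t)) l (𝓝 0) := by
    intro f c l h
    have := h.const_mul β
    rw [mul_zero] at this
    refine this.congr (fun t => ?_)
    have e : Real.exp ((1 - c) * t) = Real.exp (-c * t) * Real.exp t := by
      rw [← Real.exp_add]; ring_nf
    rw [e]; ring
  have kA := conv TA α atBot h1
  have kQ := conv TC α atBot h2
  have lA := conv TA (-α) atTop (by simpa using h4)
  have lQ := conv TC (-α) atTop (by simpa using h5)
  set W : ℝ := 2 * (ℓ : ℝ) * π with hW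
  have lw : Tendsto (fun t => Real.exp (-(-α) * t) * (w t - W)) atTop (𝓝 0) := by simpa using h6
  -- behaviour at -∞
  set γ := min α (1 / 2) with hγdef
  have hγ : 0 < γ := lt_min hα (by norm_num)
  have hexpα : Tendsto (fun t => Real.exp (α * t)) atBot (𝓝 0) :=
    Real.tendsto_exp_atBot.comp (tendsto_id.const_mul_atBot hα)
  have hexpγ : Tendsto (fun t => Real.exp (γ * t)) atBot (𝓝 0) :=
    Real.tendsto_exp_atBot.comp (tendsto_id.const_mul_atBot hγ)
  have hexpT : Tendsto (fun t => Real.exp (-α * t)) atTop (𝓝 0) :=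
    Real.tendsto_exp_atBot.comp (tendsto_id.const_mul_atTop_of_neg (by linarith))
  have p16 : (0 : ℝ) < 1 / 16 := by norm_num
  have ew := ev_small p16 h3
  have eA := ev_small p16 kA
  have eQ := ev_small p16 kQ
  have fw := ev_small one_pos lw
  have fA := ev_small one_pos lA
  have fQ := ev_small one_pos lQ
  -- limits
  have mkBot : ∀ f : ℝ → ℝ, (∀ᶠ t in atBot, |f t| ≤ 1 / 16 * Real.exp (α * t)) →
      Tendsto (fun t => |f t|) atBot (𝓝 0) := by
    intro f hf
    refine (tendsto_zero_iff_abs_tendsto_zero f).1 ?_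
    refine squeeze_zero_norm' hf ?_
    have h := hexpα.const_mul (1 / 16)
    rwa [mul_zero] at h
  have mkTop : ∀ f : ℝ → ℝ, (∀ᶠ t in atTop, |f t| ≤ 1 * Real.exp (-α * t)) →
      Tendsto f atTop (𝓝 0) := by
    intro f hf
    refine squeeze_zero_norm' hf ?_
    simpa using hexpT.const_mul 1
  have tw : Tendsto (fun t => |w t|) atTop (𝓝 |W|) := by
    have := (mkTop _ fw).add_const W
    simp only [sub_add_cancel, zero_add] at this
    exact this.abs
  have tA : Tendsto (fun t => |A t|) atTop (𝓝 |0|) := (mkTop _ fA).abs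
  have tQ : Tendsto (fun t => |Q t|) atTop (𝓝 |0|) := (mkTop _ fQ).abs
  obtain ⟨K, hK⟩ : ∃ K, ∀ t, 2 * |w t| + 2 + 2 * |A t| + |Q t| ≤ K := by
    refine bounded_of_limits (by fun_prop)
      ((((mkBot _ ew).const_mul 2).add_const 2).add ((mkBot _ eA).const_mul 2) |>.add (mkBot _ eQ))
      (((tw.const_mul 2).add_const 2).add (tA.const_mul 2) |>.add tQ)
  obtain ⟨T, hT⟩ := eventually_atBot.1 (ew.and (eA.and (eQ.and ((eventually_le_atBot 0).and
    (hexpγ.eventually (ge_mem_nhds (by norm_num : (0 : ℝ) < 1 / 4)))))))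
  have hle : ∀ t, t ≤ T → 1 / 16 * Real.exp (α * t) ≤ 1 / 16 * Real.exp (γ * t) := by
    intro t ht
    have h0 := (hT t ht).2.2.2.1
    refine mul_le_mul_of_nonneg_left (Real.exp_le_exp.2 ?_) p16.le
    have : γ ≤ α := min_le_left _ _
    nlinarith
  obtain ⟨y, z, hy, hz, hy0⟩ := exists_global hwc hAc hQc hγ (min_le_right _ _)
    (hT T le_rfl).2.2.2.2
    (fun t ht => (hT t ht).1.trans (hle t ht)) (fun t ht => (hT t ht).2.1.trans (hle t ht))
    (fun t ht => (hT t ht).2.2.1.trans (hle t ht)) hK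
  obtain ⟨T1, hT1⟩ := eventually_atTop.1 (fw.and (fA.and fQ))
  obtain ⟨m, hm⟩ := conv_top (y := y) (z := z) (W := W) (α := α) (T1 := T1)
    (C := 4 + 2 * |W| + 3) (B := K + 2 * (|W| + 1))
    (ρ := fun t => FF (w t) (A t) (Q t) (y t) - 2 * (W * Real.cos (y t) - Real.sin (y t)))
    hα hy (fun t => (hz t).congr_deriv (by ring))
    (fun t => by
      have q1 := (FF_bound (w t) (A t) (Q t) (y t)).trans (hK t)
      have q2 : |W * Real.cos (y t)| ≤ |W| := by
        rw [abs_mul]; exact mul_le_of_le_one_right (abs_nonneg _) (Real.abs_cos_le_one _)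
      have q3 := Real.abs_sin_le_one (y t)
      rw [abs_le] at q1 q2 q3 ⊢
      constructor <;> linarith [q1.1, q1.2, q2.1, q2.2, q3.1, q3.2])
    (fun t ht => by
      obtain ⟨r1, r2, r3⟩ := hT1 t ht
      refine (FF_diff (w t) (A t) (Q t) W (y t) ⟨ℓ, hW⟩).trans ?_
      have := mul_le_mul_of_nonneg_left r1 (by positivity : 0 ≤ 4 + 2 * |W|)
      simp only [A, Q]
      linarith)
  refine ⟨y, z, hy, fun t => (hz t).congr_deriv ?_, 0, m, by simpa using hy0, hm⟩
  simp only [FF, A, Q]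
  ring
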